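/- arXiv:2208.13089 — 2 statements merged into one kernel-verified Lean document; each statement's English description precedes it below -/
import Mathlib

section
/- Let A, D be densely defined closed operators and C closable with dom(A) ⊆ dom(C) and ρ(A) ≠ ∅, and let 𝒜 be the closed lower-triangular operator matrix [[A,0],[C,D̄]]. If λ ∈ σ_{e2}(A) and D̄ − λ is semi-Fredholm with finite codimension of its closed range (λ ∉ σ*_{e2}(D̄)), then λ ∈ σ_{e2}(𝒜). -/
open Filter
open scoped InnerProductSpace

/-- The essential spectrum `σ_{e2}` of a partially defined operator: `λ` belongs to it iff there
is a singular (Weyl) sequence, i.e. unit vectors of the domain converging weakly to `0` with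
`‖(T − λ)xₙ‖ → 0`. -/
def sigmaE2 {E : Type*} [NormedAddCommGroup E] [NormedSpace ℂ E] (T : E →ₗ.[ℂ] E) : Set ℂ :=
  {l | ∃ x : ℕ → T.domain, (∀ n, ‖(x n : E)‖ = 1) ∧
    (∀ φ : E →L[ℂ] ℂ, Tendsto (fun n => φ (x n)) atTop (nhds 0)) ∧
    Tendsto (fun n => ‖T (x n) - l • ((x n : E))‖) atTop (nhds 0)}

/-- `λ` belongs to the resolvent set of the partially defined operator `T`. -/
def inResolvent {E : Type*} [NormedAddCommGroup E] [NormedSpace ℂ E]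
    (T : E →ₗ.[ℂ] E) (l : ℂ) : Prop :=
  ∃ R : E →L[ℂ] E, (∀ y : E, ∃ h : R y ∈ T.domain, T ⟨R y, h⟩ - l • R y = y) ∧
    (∀ x : T.domain, R (T x - l • (x : E)) = (x : E))

/-- The range of `T − λ`, as a submodule of the target space. -/
def shiftedRange {E : Type*} [NormedAddCommGroup E] [NormedSpace ℂ E]
    (T : E →ₗ.[ℂ] E) (l : ℂ) : Submodule ℂ E :=
  LinearMap.range (T.toFun - l • T.domain.subtype)

/-- A continuous linear surjection from a Hilbert space onto a Banach space has a continuous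
linear right inverse. -/
theorem ContinuousLinearMap.exists_rightInverse_of_surjective_of_hilbert {E F : Type*}
    [NormedAddCommGroup E] [InnerProductSpace ℂ E] [CompleteSpace E]
    [NormedAddCommGroup F] [NormedSpace ℂ F] [CompleteSpace F]
    (f : E →L[ℂ] F) (hf : Function.Surjective f) :
    ∃ g : F →L[ℂ] E, ∀ y, f (g y) = y := by
  have hK : IsClosed (f.ker : Set E) := f.isClosed_ker
  have : CompleteSpace f.ker := hK.completeSpace_coe
  let h : f.kerᗮ →L[ℂ] F := f.comp f.kerᗮ.subtypeL
  have hinj : h.ker = ⊥ := by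
    refine LinearMap.ker_eq_bot'.mpr fun m hm => ?_
    have h1 : (m : E) ∈ f.ker := hm
    have h2 : (m : E) = 0 :=
      (Submodule.disjoint_def.mp f.ker.orthogonal_disjoint) _ h1 m.2
    exact Subtype.ext h2
  have hsurj : h.range = ⊤ := by
    refine LinearMap.range_eq_top.mpr fun y => ?_
    obtain ⟨x, rfl⟩ := hf y
    refine ⟨⟨f.kerᗮ.starProjection x, Submodule.starProjection_apply_mem _ _⟩, ?_⟩
    have h1 := Submodule.starProjection_add_starProjection_orthogonal (K := f.ker) x
    have h2 : f (f.ker.starProjection x) = 0 :=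
      Submodule.starProjection_apply_mem f.ker x
    calc f (f.kerᗮ.starProjection x)
        = f (f.ker.starProjection x + f.kerᗮ.starProjection x) := by rw [map_add, h2, zero_add]
      _ = f x := by rw [h1]
  refine ⟨f.kerᗮ.subtypeL.comp ((ContinuousLinearEquiv.ofBijective h hinj hsurj).symm : F →L[ℂ] f.kerᗮ), fun y => ?_⟩
  exact ContinuousLinearEquiv.ofBijective_apply_symm_apply h hinj hsurj y

/-- If `T` is a closed operator on a Hilbert space and `T - l` has closed range, then
`T - l` has a bounded right inverse on its range. -/
theorem LinearPMap.exists_rightInverse_shiftedRange {H : Type*}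
    [NormedAddCommGroup H] [InnerProductSpace ℂ H] [CompleteSpace H]
    (T : H →ₗ.[ℂ] H) (hT : T.IsClosed) (l : ℂ)
    (hran : _root_.IsClosed (shiftedRange T l : Set H)) :
    ∃ S : shiftedRange T l →L[ℂ] H, ∀ m, ∃ h : S m ∈ T.domain, T ⟨S m, h⟩ - l • S m = m := by
  let e := WithLp.prodContinuousLinearEquiv 2 ℂ H H
  let G : Submodule ℂ (WithLp 2 (H × H)) := T.graph.comap e.toLinearEquiv.toLinearMap
  have hG : _root_.IsClosed (G : Set (WithLp 2 (H × H))) :=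
    _root_.IsClosed.preimage e.continuous hT
  have : CompleteSpace G := hG.completeSpace_coe
  have : CompleteSpace (shiftedRange T l) := hran.completeSpace_coe
  let p : G →L[ℂ] H × H := (e : WithLp 2 (H × H) →L[ℂ] H × H).comp G.subtypeL
  have hp (g : G) : ∃ h : (p g).1 ∈ T.domain, T ⟨(p g).1, h⟩ = (p g).2 := by
    have hg : p g ∈ T.graph := g.2
    obtain ⟨x, hx⟩ := T.mem_graph_iff'.mp hg
    rw [← hx]
    exact ⟨x.2, rfl⟩
  let q : G →L[ℂ] H := (ContinuousLinearMap.snd ℂ H H - l • ContinuousLinearMap.fst ℂ H H).comp p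
  have hq (g : G) : q g ∈ shiftedRange T l := by
    obtain ⟨h, hg⟩ := hp g
    refine ⟨⟨(p g).1, h⟩, ?_⟩
    change T ⟨(p g).1, h⟩ - l • (p g).1 = (p g).2 - l • (p g).1
    rw [hg]
  have hsurj : Function.Surjective (q.codRestrict _ hq) := by
    rintro ⟨_, x, rfl⟩
    exact ⟨⟨e.symm (x, T x), T.mem_graph x⟩, rfl⟩
  obtain ⟨g, hg⟩ := (q.codRestrict _ hq).exists_rightInverse_of_surjective_of_hilbert hsurj
  refine ⟨(ContinuousLinearMap.fst ℂ H H).comp (p.comp g), fun m => ?_⟩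
  obtain ⟨h, hgm⟩ := hp (g m)
  refine ⟨h, ?_⟩
  have h1 : (p (g m)).2 - l • (p (g m)).1 = m := congrArg Subtype.val (hg m)
  change T ⟨(p (g m)).1, h⟩ - l • (p (g m)).1 = m
  rw [hgm, h1]

/-- A closable operator composed with a bounded operator mapping into its domain is bounded. -/
theorem LinearPMap.IsClosable.exists_comp_continuousLinearMap {E F G : Type*}
    [NormedAddCommGroup E] [NormedSpace ℂ E] [CompleteSpace E]
    [NormedAddCommGroup F] [NormedSpace ℂ F]
    [NormedAddCommGroup G] [NormedSpace ℂ G] [CompleteSpace G]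
    {C : F →ₗ.[ℂ] G} (hC : C.IsClosable) (R : E →L[ℂ] F) (hR : ∀ y, R y ∈ C.domain) :
    ∃ B : E →L[ℂ] G, ∀ y, B y = C ⟨R y, hR y⟩ := by
  let B : E →ₗ[ℂ] G := C.toFun.comp ((R : E →ₗ[ℂ] F).codRestrict C.domain hR)
  have hgraph (y : E) : (R y, B y) ∈ C.closure.graph :=
    LinearPMap.le_graph_of_le C.le_closure (C.mem_graph ⟨R y, hR y⟩)
  refine ⟨ContinuousLinearMap.ofSeqClosedGraph (g := B) fun u x y hu hBu => ?_, fun y => rfl⟩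
  have hlim : (R x, y) ∈ C.closure.graph :=
    hC.closure_isClosed.mem_of_tendsto
      (((R.continuous.tendsto x).comp hu).prodMk_nhds hBu)
      (Eventually.of_forall fun n => hgraph (u n))
  exact C.closure.mem_graph_snd_inj hlim (hgraph x) rfl

/-- A continuous linear map into a finite-dimensional space sends weakly null sequences to
norm null sequences. -/
theorem ContinuousLinearMap.tendsto_zero_of_weakly_null {E F ι : Type*}
    [NormedAddCommGroup E] [NormedSpace ℂ E]
    [NormedAddCommGroup F] [NormedSpace ℂ F] [FiniteDimensional ℂ F]
    (f : E →L[ℂ] F) {L : Filter ι} {u : ι → E}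
    (hu : ∀ φ : E →L[ℂ] ℂ, Tendsto (fun n => φ (u n)) L (nhds 0)) :
    Tendsto (fun n => f (u n)) L (nhds 0) := by
  let e := (Module.finBasis ℂ F).equivFunL
  have h : Tendsto (fun n => e (f (u n))) L (nhds 0) :=
    tendsto_pi_nhds.mpr fun i =>
      hu ((ContinuousLinearMap.proj (φ := fun _ => ℂ) i).comp ((e : F →L[ℂ] Fin (Module.finrank ℂ F) → ℂ).comp f))
  have h' := (e.symm.continuous.tendsto 0).comp h
  simpa [Function.comp_def] using h'

/-- With `A`, `C`, `D` and the closed triangular matrix `𝒜 = [[A,0],[C,D̄]]`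
as before: if `λ ∈ σ_{e2}(A)` and `D̄ − λ` has closed range of finite codimension
(`λ ∉ σ*_{e2}(D̄)`, i.e. `D̄ − λ ∈ Φ₋`), then `λ ∈ σ_{e2}(𝒜)`. -/
theorem stmt_7 {H₁ H₂ : Type*}
    [NormedAddCommGroup H₁] [InnerProductSpace ℂ H₁] [CompleteSpace H₁]
    [NormedAddCommGroup H₂] [InnerProductSpace ℂ H₂] [CompleteSpace H₂]
    (A : H₁ →ₗ.[ℂ] H₁) (D : H₂ →ₗ.[ℂ] H₂) (C : H₁ →ₗ.[ℂ] H₂)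
    (hAdense : Dense (A.domain : Set H₁)) (hAclosed : IsClosed (A.graph : Set (H₁ × H₁)))
    (hDdense : Dense (D.domain : Set H₂)) (hDclosable : D.IsClosable)
    (hCclosable : C.IsClosable) (hCdom : A.domain ≤ C.domain)
    (hAres : ∃ l₀ : ℂ, inResolvent A l₀)
    (𝒜 : (H₁ × H₂) →ₗ.[ℂ] (H₁ × H₂))
    (h𝒜dom : ∀ p : H₁ × H₂, p ∈ 𝒜.domain ↔ p.1 ∈ A.domain ∧ p.2 ∈ D.closure.domain)
    (h𝒜act : ∀ (p : 𝒜.domain) (h1 : (p : H₁ × H₂).1 ∈ A.domain)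
      (h2 : (p : H₁ × H₂).2 ∈ D.closure.domain),
      𝒜 p = (A ⟨(p : H₁ × H₂).1, h1⟩,
        C ⟨(p : H₁ × H₂).1, hCdom h1⟩ + D.closure ⟨(p : H₁ × H₂).2, h2⟩))
    (l : ℂ) (hlA : l ∈ sigmaE2 A)
    (hclosedran : IsClosed ((shiftedRange D.closure l : Submodule ℂ H₂) : Set H₂))
    (hfincodim : FiniteDimensional ℂ (H₂ ⧸ shiftedRange D.closure l)) :
    l ∈ sigmaE2 𝒜 := by
  obtain ⟨l₀, R, hR, hRl⟩ := hAres
  obtain ⟨x, hx1, hxw, hxA⟩ := hlA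
  have hRC (y : H₁) : R y ∈ C.domain := hCdom (hR y).1
  obtain ⟨B, hB⟩ := hCclosable.exists_comp_continuousLinearMap R hRC
  obtain ⟨S, hS⟩ :=
    D.closure.exists_rightInverse_shiftedRange hDclosable.closure_isClosed l hclosedran
  let M := shiftedRange D.closure l
  have : CompleteSpace M := hclosedran.completeSpace_coe
  have : FiniteDimensional ℂ Mᗮ :=
    (M.quotientEquivOfIsCompl Mᗮ M.isCompl_orthogonal).finiteDimensional
  let u : ℕ → H₁ := fun n => A (x n) - l₀ • (x n : H₁)
  have huw (φ : H₁ →L[ℂ] ℂ) : Tendsto (fun n => φ (u n)) atTop (nhds 0) := by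
    have h1 := (φ.continuous.tendsto 0).comp (tendsto_zero_iff_norm_tendsto_zero.mpr hxA)
    have h2 := (hxw φ).const_mul (l - l₀)
    have h3 := h1.add h2
    simp only [map_zero, mul_zero, add_zero] at h3
    refine h3.congr fun n => ?_
    simp only [u, Function.comp_apply, map_sub, map_smul, smul_eq_mul]
    ring
  have hBu (n : ℕ) (h : (x n : H₁) ∈ C.domain) : C ⟨x n, h⟩ = B (u n) := by
    rw [hB]
    congr 2
    exact (hRl (x n)).symm
  let Y : H₁ →L[ℂ] H₂ := -(S.comp (M.orthogonalProjectionOnto.comp B))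
  have hYdom (v : H₁) : Y v ∈ D.closure.domain :=
    D.closure.domain.neg_mem (hS (M.orthogonalProjectionOnto (B v))).1
  have hYact (v : H₁) (h : Y v ∈ D.closure.domain) :
      B v + D.closure ⟨Y v, h⟩ - l • Y v = Mᗮ.starProjection (B v) := by
    obtain ⟨h', hm⟩ := hS (M.orthogonalProjectionOnto (B v))
    have h1 : (⟨Y v, h⟩ : D.closure.domain) = -⟨S (M.orthogonalProjectionOnto (B v)), h'⟩ := rfl
    have h2 : Y v = -S (M.orthogonalProjectionOnto (B v)) := rfl
    have h3 := Submodule.starProjection_add_starProjection_orthogonal (K := M) (B v)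
    have h4 : M.starProjection (B v) = M.orthogonalProjectionOnto (B v) := rfl
    rw [h4, ← hm] at h3
    rw [h1, LinearPMap.map_neg, h2]
    nth_rewrite 1 [← h3]
    module
  let z : ℕ → H₁ × H₂ := fun n => (x n, Y (u n))
  have hzdom (n : ℕ) : z n ∈ 𝒜.domain := (h𝒜dom _).mpr ⟨(x n).2, hYdom _⟩
  have hznorm (n : ℕ) : 1 ≤ ‖z n‖ := (hx1 n).symm.le.trans (norm_fst_le (z n))
  have hzw (φ : H₁ × H₂ →L[ℂ] ℂ) : Tendsto (fun n => φ (z n)) atTop (nhds 0) := by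
    have h1 := hxw (φ.comp (ContinuousLinearMap.inl ℂ H₁ H₂))
    have h2 := huw ((φ.comp (ContinuousLinearMap.inr ℂ H₁ H₂)).comp Y)
    have h3 := h1.add h2
    rw [add_zero] at h3
    refine h3.congr fun n => ?_
    simp [z, ← map_add]
  have hzA : Tendsto (fun n => 𝒜 ⟨z n, hzdom n⟩ - l • z n) atTop (nhds 0) := by
    have h1 := tendsto_zero_iff_norm_tendsto_zero.mpr hxA
    have h2 := (Mᗮ.orthogonalProjectionOnto.comp B).tendsto_zero_of_weakly_null huw
    have h3 := (Mᗮ.subtypeL.continuous.tendsto 0).comp h2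
    rw [map_zero] at h3
    refine (h1.prodMk_nhds h3).congr fun n => ?_
    rw [h𝒜act ⟨z n, hzdom n⟩ (x n).2 (hYdom _)]
    refine Prod.ext rfl ?_
    change Mᗮ.starProjection (B (u n)) =
      C ⟨x n, _⟩ + D.closure ⟨Y (u n), _⟩ - l • Y (u n)
    rw [hBu, hYact]
  let c : ℕ → ℂ := fun n => ((‖z n‖⁻¹ : ℝ) : ℂ)
  have hc (n : ℕ) : ‖c n‖ = ‖z n‖⁻¹ := by simp [c]
  have hc1 (n : ℕ) : ‖c n‖ ≤ 1 := by
    rw [hc]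
    exact inv_le_one_of_one_le₀ (hznorm n)
  refine ⟨fun n => c n • ⟨z n, hzdom n⟩, fun n => ?_, fun φ => ?_, ?_⟩
  · rw [Submodule.coe_smul, norm_smul, hc]
    exact inv_mul_cancel₀ (by linarith [hznorm n])
  · refine squeeze_zero_norm (fun n => ?_) (tendsto_zero_iff_norm_tendsto_zero.mp (hzw φ))
    rw [Submodule.coe_smul, map_smul, norm_smul]
    exact mul_le_of_le_one_left (norm_nonneg _) (hc1 n)
  · refine squeeze_zero (fun n => norm_nonneg _) (fun n => ?_)
      (tendsto_zero_iff_norm_tendsto_zero.mp hzA)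
    rw [LinearPMap.map_smul, Submodule.coe_smul, smul_comm l, ← smul_sub, norm_smul]
    exact mul_le_of_le_one_left (norm_nonneg _) (hc1 n)
end

section
/- Let A, D be densely defined closed operators with C closable, dom(A) ⊆ dom(C), ρ(A) ≠ ∅. If λ ∉ σ_{e2}(A) ∪ σ_{e2}(D̄), i.e. both A−λ and D̄−λ are semi-Fredholm with closed range and finite-dimensional kernel, then the closed triangular operator matrix 𝒜 = [[A,0],[C,D̄]] satisfies λ ∉ σ_{e2}(𝒜); i.e. 𝒜−λ has closed range and finite-dimensional kernel. -/
open Filter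
open scoped InnerProductSpace

/-- The kernel of `T − λ`, as a submodule of the domain. -/
def shiftedKer {E : Type*} [NormedAddCommGroup E] [NormedSpace ℂ E]
    (T : E →ₗ.[ℂ] E) (l : ℂ) : Submodule ℂ T.domain :=
  LinearMap.ker (T.toFun - l • T.domain.subtype)

/-- The continuous linear map `(x, y) ↦ y - l • x`, which sends `(x, T x)` to `(T - l) x`. -/
def graphShift {E : Type*} [NormedAddCommGroup E] [NormedSpace ℂ E] (l : ℂ) : E × E →L[ℂ] E :=
  ContinuousLinearMap.snd ℂ E E - l • ContinuousLinearMap.fst ℂ E E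

section FredholmEstimate

variable {E F : Type*} [NormedAddCommGroup E] [NormedSpace ℂ E]
  [NormedAddCommGroup F] [NormedSpace ℂ F]

@[simp]
theorem graphShift_apply (l : ℂ) (p : E × E) : graphShift l p = p.2 - l • p.1 := rfl

theorem mem_shiftedRange {T : E →ₗ.[ℂ] E} {l : ℂ} {y : E} :
    y ∈ shiftedRange T l ↔ ∃ x : T.domain, T x - l • (x : E) = y := Iff.rfl

theorem mem_shiftedKer {T : E →ₗ.[ℂ] E} {l : ℂ} {x : T.domain} :
    x ∈ shiftedKer T l ↔ T x - l • (x : E) = 0 := Iff.rfl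

/-- A closed operator with closed range and finite-dimensional kernel is bounded below modulo
the projection onto its kernel. -/
theorem exists_norm_le_of_isClosed_shiftedRange [CompleteSpace E] (T : E →ₗ.[ℂ] E) (l : ℂ)
    (hT : IsClosed (T.graph : Set (E × E)))
    (hran : IsClosed (shiftedRange T l : Set E))
    (hker : FiniteDimensional ℂ (shiftedKer T l)) :
    ∃ N : Submodule ℂ E, FiniteDimensional ℂ N ∧ ∃ P : E →L[ℂ] N, ∃ c : ℝ, 0 ≤ c ∧
      ∀ x : T.domain, ‖(x : E)‖ ≤ c * (‖T x - l • (x : E)‖ + ‖P x‖) := by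
  have : CompleteSpace T.graph := hT.completeSpace_coe
  have : CompleteSpace (shiftedRange T l) := hran.completeSpace_coe
  have hmem (p : T.graph) : graphShift l (p : E × E) ∈ shiftedRange T l := by
    obtain ⟨x, hx, hy⟩ := T.mem_graph_iff.1 p.2
    exact ⟨x, by simp [← hx, ← hy]⟩
  let f : T.graph →L[ℂ] shiftedRange T l :=
    ((graphShift l).comp T.graph.subtypeL).codRestrict _ hmem
  have hf : Function.Surjective f := by
    rintro ⟨_, x, rfl⟩
    exact ⟨⟨_, T.mem_graph x⟩, rfl⟩
  obtain ⟨C, hC, hpre⟩ := f.exists_preimage_norm_le hf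
  let N : Submodule ℂ E := (shiftedKer T l).map T.domain.subtype
  obtain ⟨P, hP⟩ := Submodule.ClosedComplemented.of_finiteDimensional N
  refine ⟨N, inferInstance, P, C + ‖P‖ * C + 1, by positivity, fun x ↦ ?_⟩
  obtain ⟨⟨⟨z, w⟩, hzw⟩, hfz, hz⟩ := hpre ⟨T x - l • (x : E), x, rfl⟩
  obtain ⟨x', rfl, rfl⟩ := T.mem_graph_iff.1 hzw
  have heq : T x' - l • (x' : E) = T x - l • (x : E) := congrArg Subtype.val hfz
  have hx' : ‖(x' : E)‖ ≤ C * ‖T x - l • (x : E)‖ := (norm_fst_le _).trans hz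
  have hN : (x : E) - x' ∈ N := by
    refine ⟨x - x', mem_shiftedKer.2 ?_, rfl⟩
    rw [T.map_sub, Submodule.coe_sub, smul_sub, sub_sub_sub_comm, heq, sub_self]
  have hPd : P (x : E) - P x' = ⟨x - x', hN⟩ := by rw [← map_sub]; exact hP ⟨_, hN⟩
  have hd : ‖(x : E) - x'‖ ≤ ‖P x‖ + ‖P‖ * ‖(x' : E)‖ := by
    calc ‖(x : E) - x'‖ = ‖P (x : E) - P x'‖ := by rw [hPd]; rfl
      _ ≤ ‖P x‖ + ‖P x'‖ := norm_sub_le _ _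
      _ ≤ _ := by gcongr; exact P.le_opNorm _
  have htri : ‖(x : E)‖ ≤ ‖(x' : E)‖ + ‖(x : E) - x'‖ := norm_le_norm_add_norm_sub' _ _
  have hmul := mul_le_mul_of_nonneg_left hx' (norm_nonneg P)
  have h1 : 0 ≤ (C + ‖P‖ * C) * ‖P x‖ := by positivity
  have h2 := norm_nonneg (T x - l • (x : E))
  linarith

variable [FiniteDimensional ℂ F] {T : E →ₗ.[ℂ] E} {l : ℂ} {P : E →L[ℂ] F} {c : ℝ}

theorem finiteDimensional_shiftedKer_of_norm_le
    (h : ∀ x : T.domain, ‖(x : E)‖ ≤ c * (‖T x - l • (x : E)‖ + ‖P x‖)) :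
    FiniteDimensional ℂ (shiftedKer T l) := by
  refine Module.Finite.of_injective
    (P.toLinearMap ∘ₗ T.domain.subtype ∘ₗ (shiftedKer T l).subtype) ?_
  rw [injective_iff_map_eq_zero]
  intro x hx
  have hx0 : P (x : T.domain) = 0 := hx
  have := h x
  rw [mem_shiftedKer.1 x.2, hx0] at this
  exact Subtype.ext (Subtype.ext (norm_le_zero_iff.1 (by simpa using this)))

theorem notMem_sigmaE2_of_norm_le
    (h : ∀ x : T.domain, ‖(x : E)‖ ≤ c * (‖T x - l • (x : E)‖ + ‖P x‖)) :
    l ∉ sigmaE2 T := by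
  rintro ⟨x, hx1, hxw, hxT⟩
  let e := (Module.finBasis ℂ F).equivFunL
  have he : Tendsto (fun n ↦ e (P (x n))) atTop (nhds 0) :=
    tendsto_pi_nhds.2 fun i ↦
      hxw (((ContinuousLinearMap.proj (R := ℂ) (φ := fun _ ↦ ℂ) i).comp
        e.toContinuousLinearMap).comp P)
  have hP : Tendsto (fun n ↦ P (x n)) atTop (nhds 0) := by
    simpa [Function.comp_def] using (e.symm.continuous.tendsto 0).comp he
  have hlim := (hxT.add hP.norm).const_mul c
  rw [norm_zero, add_zero, mul_zero] at hlim
  have := ge_of_tendsto' hlim fun n ↦ (hx1 n).symm.le.trans (h (x n))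
  linarith

theorem isClosed_shiftedRange_of_norm_le [CompleteSpace E]
    (hT : IsClosed (T.graph : Set (E × E))) (hc : 0 ≤ c)
    (h : ∀ x : T.domain, ‖(x : E)‖ ≤ c * (‖T x - l • (x : E)‖ + ‖P x‖)) :
    IsClosed (shiftedRange T l : Set E) := by
  have : CompleteSpace T.graph := hT.completeSpace_coe
  let K : T.graph →L[ℂ] E × F :=
    ((graphShift l).prod (P.comp (ContinuousLinearMap.fst ℂ E E))).comp T.graph.subtypeL
  have hK : AntilipschitzWith (2 * c + 1 + ‖l‖ * (2 * c)).toNNReal K := by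
    refine AddMonoidHomClass.antilipschitz_of_bound K fun p ↦ ?_
    rw [Real.coe_toNNReal _ (by positivity)]
    obtain ⟨⟨z, w⟩, hzw⟩ := p
    obtain ⟨x, rfl, rfl⟩ := T.mem_graph_iff.1 hzw
    have h1 : ‖T x - l • (x : E)‖ ≤ ‖K ⟨_, hzw⟩‖ := norm_fst_le (K ⟨_, hzw⟩)
    have h2 : ‖P x‖ ≤ ‖K ⟨_, hzw⟩‖ := norm_snd_le (K ⟨_, hzw⟩)
    set k := ‖K ⟨_, hzw⟩‖
    have hk : 0 ≤ k := norm_nonneg _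
    have hx : ‖(x : E)‖ ≤ 2 * c * k := (h x).trans (by nlinarith)
    have hlx : ‖l‖ * ‖(x : E)‖ ≤ ‖l‖ * (2 * c * k) := by gcongr
    have hTx : ‖T x‖ ≤ ‖l • (x : E)‖ + ‖T x - l • (x : E)‖ := norm_le_norm_add_norm_sub' _ _
    rw [norm_smul] at hTx
    have : 0 ≤ ‖l‖ * (2 * c * k) := by positivity
    have : 0 ≤ 2 * c * k := by positivity
    exact max_le (by dsimp; linarith) (by dsimp; linarith)
  have hKcl : IsClosed (K.range : Set (E × F)) := by
    rw [LinearMap.coe_range]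
    exact hK.isClosed_range K.uniformContinuous
  let V : Submodule ℂ (E × F) := (LinearMap.inr ℂ E F).range
  have hcl := Submodule.isClosed_sup_finiteDimensional K.range V hKcl
  have hset : (shiftedRange T l : Set E) =
      (fun y : E ↦ (y, (0 : F))) ⁻¹' ((K.range ⊔ V : Submodule ℂ (E × F)) : Set (E × F)) := by
    ext y
    simp only [Set.mem_preimage, SetLike.mem_coe, Submodule.mem_sup]
    constructor
    · rintro ⟨x, rfl⟩
      exact ⟨K ⟨_, T.mem_graph x⟩, ⟨_, rfl⟩, (0, -P x), ⟨-P x, rfl⟩, by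
        ext <;> simp [K]⟩
    · rintro ⟨_, ⟨⟨⟨z, w⟩, hzw⟩, rfl⟩, _, ⟨v, rfl⟩, hy⟩
      obtain ⟨x, rfl, rfl⟩ := T.mem_graph_iff.1 hzw
      exact ⟨x, by simpa [K] using congrArg Prod.fst hy⟩
  rw [hset]
  exact hcl.preimage (by fun_prop)

end FredholmEstimate

/-- A closable operator defined on the domain of an operator with non-empty resolvent set is
relatively bounded with respect to it. -/
theorem exists_norm_le_of_isClosable {E F : Type*} [NormedAddCommGroup E] [NormedSpace ℂ E]
    [CompleteSpace E] [NormedAddCommGroup F] [NormedSpace ℂ F] [CompleteSpace F]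
    (A : E →ₗ.[ℂ] E) (C : E →ₗ.[ℂ] F) (hC : C.IsClosable) (hdom : A.domain ≤ C.domain)
    (hres : ∃ l₀ : ℂ, inResolvent A l₀) (l : ℂ) :
    ∃ a : ℝ, 0 ≤ a ∧ ∀ x : A.domain,
      ‖C ⟨x, hdom x.2⟩‖ ≤ a * (‖A x - l • (x : E)‖ + ‖(x : E)‖) := by
  obtain ⟨l₀, R, hR, hRA⟩ := hres
  have hmem (y : E) : R y ∈ C.domain := hdom (hR y).1
  let B : E →ₗ[ℂ] F := C.toFun ∘ₗ R.toLinearMap.codRestrict C.domain hmem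
  have hgraph (y : E) : (R y, B y) ∈ C.closure.graph :=
    LinearPMap.le_graph_of_le C.le_closure (C.mem_graph ⟨R y, hmem y⟩)
  have hcont : Continuous B := by
    refine B.continuous_of_seq_closed_graph fun u x y hu hBu ↦ ?_
    have hlim : (R x, y) ∈ C.closure.graph :=
      hC.closure_isClosed.mem_of_tendsto
        (((R.continuous.tendsto x).comp hu).prodMk_nhds hBu)
        (Eventually.of_forall fun n ↦ hgraph (u n))
    exact LinearPMap.mem_graph_snd_inj _ hlim (hgraph x) rfl
  let B' : E →L[ℂ] F := ⟨B, hcont⟩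
  refine ⟨‖B'‖ * (1 + ‖l - l₀‖), by positivity, fun x ↦ ?_⟩
  have hBx : B' (A x - l₀ • (x : E)) = C ⟨x, hdom x.2⟩ :=
    congrArg C (Subtype.ext (hRA x))
  have hsplit : A x - l₀ • (x : E) = (A x - l • (x : E)) + (l - l₀) • (x : E) := by
    rw [sub_smul]; abel
  have hle : ‖A x - l₀ • (x : E)‖ ≤ ‖A x - l • (x : E)‖ + ‖l - l₀‖ * ‖(x : E)‖ := by
    rw [hsplit, ← norm_smul]; exact norm_add_le _ _
  calc ‖C ⟨x, hdom x.2⟩‖ ≤ ‖B'‖ * ‖A x - l₀ • (x : E)‖ := hBx ▸ B'.le_opNorm _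
    _ ≤ ‖B'‖ * (‖A x - l • (x : E)‖ + ‖l - l₀‖ * ‖(x : E)‖) := by gcongr
    _ ≤ ‖B'‖ * ((1 + ‖l - l₀‖) * (‖A x - l • (x : E)‖ + ‖(x : E)‖)) := by
      gcongr
      have := mul_nonneg (norm_nonneg (l - l₀)) (norm_nonneg (A x - l • (x : E)))
      linarith [norm_nonneg (x : E)]
    _ = _ := by ring

/-- If `λ ∉ σ_{e2}(A) ∪ σ_{e2}(D̄)`, i.e. both `A − λ` and `D̄ − λ` are
semi-Fredholm with closed range and finite-dimensional kernel (class `Φ₊`), then the closed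
triangular operator matrix `𝒜 = [[A,0],[C,D̄]]` satisfies `λ ∉ σ_{e2}(𝒜)`; indeed `𝒜 − λ` has
closed range and finite-dimensional kernel. -/
theorem stmt_8 {H₁ H₂ : Type*}
    [NormedAddCommGroup H₁] [InnerProductSpace ℂ H₁] [CompleteSpace H₁]
    [NormedAddCommGroup H₂] [InnerProductSpace ℂ H₂] [CompleteSpace H₂]
    (A : H₁ →ₗ.[ℂ] H₁) (D : H₂ →ₗ.[ℂ] H₂) (C : H₁ →ₗ.[ℂ] H₂)
    (hAdense : Dense (A.domain : Set H₁)) (hAclosed : IsClosed (A.graph : Set (H₁ × H₁)))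
    (hDdense : Dense (D.domain : Set H₂)) (hDclosable : D.IsClosable)
    (hCclosable : C.IsClosable) (hCdom : A.domain ≤ C.domain)
    (hAres : ∃ l₀ : ℂ, inResolvent A l₀)
    (𝒜 : (H₁ × H₂) →ₗ.[ℂ] (H₁ × H₂))
    (h𝒜closed : IsClosed (𝒜.graph : Set ((H₁ × H₂) × (H₁ × H₂))))
    (h𝒜dom : ∀ p : H₁ × H₂, p ∈ 𝒜.domain ↔ p.1 ∈ A.domain ∧ p.2 ∈ D.closure.domain)
    (h𝒜act : ∀ (p : 𝒜.domain) (h1 : (p : H₁ × H₂).1 ∈ A.domain)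
      (h2 : (p : H₁ × H₂).2 ∈ D.closure.domain),
      𝒜 p = (A ⟨(p : H₁ × H₂).1, h1⟩,
        C ⟨(p : H₁ × H₂).1, hCdom h1⟩ + D.closure ⟨(p : H₁ × H₂).2, h2⟩))
    (l : ℂ)
    (hAranclosed : IsClosed ((shiftedRange A l : Submodule ℂ H₁) : Set H₁))
    (hAkerfin : FiniteDimensional ℂ (shiftedKer A l))
    (hDranclosed : IsClosed ((shiftedRange D.closure l : Submodule ℂ H₂) : Set H₂))
    (hDkerfin : FiniteDimensional ℂ (shiftedKer D.closure l)) :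
    l ∉ sigmaE2 𝒜 ∧
      IsClosed ((shiftedRange 𝒜 l : Submodule ℂ (H₁ × H₂)) : Set (H₁ × H₂)) ∧
      FiniteDimensional ℂ (shiftedKer 𝒜 l) := by
  obtain ⟨a, ha, hCa⟩ := exists_norm_le_of_isClosable A C hCclosable hCdom hAres l
  obtain ⟨N₁, _, P, c, hc, hA⟩ :=
    exists_norm_le_of_isClosed_shiftedRange A l hAclosed hAranclosed hAkerfin
  obtain ⟨N₂, _, Q, d, hd, hD⟩ :=
    exists_norm_le_of_isClosed_shiftedRange D.closure l hDclosable.closure_isClosed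
      hDranclosed hDkerfin
  let PQ : H₁ × H₂ →L[ℂ] N₁ × N₂ := P.prodMap Q
  let M : ℝ := c + d * (1 + a * (1 + c))
  have hest (p : 𝒜.domain) :
      ‖(p : H₁ × H₂)‖ ≤ M * (‖𝒜 p - l • (p : H₁ × H₂)‖ + ‖PQ p‖) := by
    obtain ⟨⟨x, y⟩, hp⟩ := p
    obtain ⟨hx, hy⟩ := (h𝒜dom _).1 hp
    set s := ‖𝒜 ⟨(x, y), hp⟩ - l • (x, y)‖ + ‖PQ (x, y)‖ with hs
    have hact := h𝒜act ⟨(x, y), hp⟩ hx hy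
    have hS : ‖A ⟨x, hx⟩ - l • x‖ ≤ ‖𝒜 ⟨(x, y), hp⟩ - l • (x, y)‖ := by
      rw [hact]; exact le_max_left _ _
    have hCD : ‖C ⟨x, hCdom hx⟩ + D.closure ⟨y, hy⟩ - l • y‖ ≤
        ‖𝒜 ⟨(x, y), hp⟩ - l • (x, y)‖ := by
      rw [hact]; exact le_max_right _ _
    have hPx : ‖P x‖ ≤ ‖PQ (x, y)‖ := norm_fst_le (PQ (x, y))
    have hQy : ‖Q y‖ ≤ ‖PQ (x, y)‖ := norm_snd_le (PQ (x, y))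
    have hPQ := norm_nonneg (PQ (x, y))
    have h𝒜 := norm_nonneg (𝒜 ⟨(x, y), hp⟩ - l • (x, y))
    have hs0 : 0 ≤ s := by positivity
    have hxs : ‖x‖ ≤ c * s :=
      (hA ⟨x, hx⟩).trans (mul_le_mul_of_nonneg_left (add_le_add hS hPx) hc)
    have hCs : ‖C ⟨x, hCdom hx⟩‖ ≤ a * (s + c * s) :=
      (hCa ⟨x, hx⟩).trans (mul_le_mul_of_nonneg_left (by dsimp; linarith) ha)
    have hDs : ‖D.closure ⟨y, hy⟩ - l • y‖ ≤
        ‖𝒜 ⟨(x, y), hp⟩ - l • (x, y)‖ + a * (s + c * s) := by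
      have hsub := norm_sub_le (C ⟨x, hCdom hx⟩ + D.closure ⟨y, hy⟩ - l • y) (C ⟨x, hCdom hx⟩)
      rw [add_sub_assoc, add_sub_cancel_left, ← add_sub_assoc] at hsub
      linarith
    have hDQ : ‖D.closure ⟨y, hy⟩ - l • y‖ + ‖Q y‖ ≤ s + a * (s + c * s) := by linarith
    have hys : ‖y‖ ≤ d * (s + a * (s + c * s)) :=
      (hD ⟨y, hy⟩).trans (mul_le_mul_of_nonneg_left hDQ hd)
    have h₁ : 0 ≤ c * s := by positivity
    have h₂ : 0 ≤ d * (s + a * (s + c * s)) := by positivity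
    refine (max_le (b := ‖y‖) (hxs.trans ?_) (hys.trans ?_) : ‖(x, y)‖ ≤ M * s)
    · simp only [M]; linarith
    · simp only [M]; linarith
  exact ⟨notMem_sigmaE2_of_norm_le hest,
    isClosed_shiftedRange_of_norm_le h𝒜closed (by positivity) hest,
    finiteDimensional_shiftedKer_of_norm_le hest⟩
end
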